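/- arXiv:1702.01754 — 13 statements merged into one kernel-verified Lean document; each statement's English description precedes it below -/
import Mathlib

section
/- Let (x₂,x₃): I → ℝ² be a differentiable solution on an interval I of the system x₂' = 1 − x₂(x₂+x₃), x₃' = −x₃(x₂+x₃). Then the function G(ξ) = x₂(ξ)² + 2x₂(ξ)x₃(ξ) − 1 satisfies the identity G'(ξ) = −2(x₂(ξ)+x₃(ξ))·G(ξ) for all ξ ∈ I; consequently G(ξ) = G(ξ₀)·exp(−2∫_{ξ₀}^{ξ}(x₂+x₃)) for any ξ₀, ξ ∈ I, so the sign of x₂² + 2x₂x₃ − 1 is constant along every solution (the reality region x₂² + 2x₂x₃ ≥ 1 of the scalar field is invariant under the flow). -/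
/-- A solution of the scalar linear equation `G' = f G` on the segment between `a` and `b` is
propagated by the exponential of the integral of `f`. -/
theorem eq_mul_exp_integral_of_hasDerivAt {f G : ℝ → ℝ} {a b : ℝ}
    (hf : ContinuousOn f (Set.uIcc a b))
    (hG : ∀ t ∈ Set.uIcc a b, HasDerivAt G (f t * G t) t) :
    G b = G a * Real.exp (∫ t in a..b, f t) := by
  have hab : min a b ≤ max a b := min_le_max
  -- A continuous extension of `f` makes its primitive differentiable at the endpoints too.
  let g : ℝ → ℝ := Set.IccExtend hab (Set.domRestrict (Set.Icc (min a b) (max a b)) f)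
  have hg : Continuous g := (continuousOn_iff_continuous_domRestrict.mp hf).Icc_extend'
  have hgf : ∀ t ∈ Set.uIcc a b, g t = f t := fun t ht => Set.IccExtend_of_mem hab _ ht
  have hderiv : ∀ t ∈ Set.uIcc a b,
      HasDerivAt (fun s => G s * Real.exp (-∫ u in a..s, g u)) 0 t := by
    intro t ht
    refine ((hG t ht).mul (hg.integral_hasStrictDerivAt a t).hasDerivAt.neg.exp).congr_deriv ?_
    simp only [hgf t ht, Pi.neg_apply]
    ring
  have hconst := intervalIntegral.integral_eq_sub_of_hasDerivAt hderiv (by simp)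
  simp only [intervalIntegral.integral_zero, intervalIntegral.integral_same, neg_zero,
    Real.exp_zero, mul_one] at hconst
  rw [← intervalIntegral.integral_congr hgf, ← sub_eq_zero.mp hconst.symm, mul_assoc,
    ← Real.exp_add, neg_add_cancel, Real.exp_zero, mul_one]

/-- Along any differentiable solution of `x₂' = 1 − x₂(x₂+x₃)`, `x₃' = −x₃(x₂+x₃)`
on an interval `I`, the function `G = x₂² + 2x₂x₃ − 1` satisfies
`G' = −2(x₂+x₃)G`, hence `G(ξ) = G(ξ₀)·exp(−2∫_{ξ₀}^{ξ}(x₂+x₃))`, so the sign of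
`x₂² + 2x₂x₃ − 1` is constant along every solution (the reality region
`x₂² + 2x₂x₃ ≥ 1` is invariant under the flow). -/
theorem stmt2 (I : Set ℝ) (hI : I.OrdConnected) (x2 x3 : ℝ → ℝ)
    (h2 : ∀ ξ ∈ I, HasDerivAt x2 (1 - x2 ξ * (x2 ξ + x3 ξ)) ξ)
    (h3 : ∀ ξ ∈ I, HasDerivAt x3 (-(x3 ξ) * (x2 ξ + x3 ξ)) ξ)
    (G : ℝ → ℝ) (hG : ∀ ξ, G ξ = (x2 ξ) ^ 2 + 2 * x2 ξ * x3 ξ - 1) :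
    (∀ ξ ∈ I, HasDerivAt G (-2 * (x2 ξ + x3 ξ) * G ξ) ξ) ∧
    (∀ ξ₀ ∈ I, ∀ ξ ∈ I,
      G ξ = G ξ₀ * Real.exp (-2 * ∫ t in ξ₀..ξ, (x2 t + x3 t))) ∧
    (∀ ξ₀ ∈ I, ∀ ξ ∈ I, 0 ≤ G ξ₀ → 0 ≤ G ξ) := by
  have hderiv : ∀ ξ ∈ I, HasDerivAt G (-2 * (x2 ξ + x3 ξ) * G ξ) ξ := by
    intro ξ hξ
    rw [funext hG]
    refine ((((h2 ξ hξ).pow 2).add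
      (((h2 ξ hξ).const_mul 2).mul (h3 ξ hξ))).sub_const 1).congr_deriv ?_
    push_cast
    ring
  have hexp : ∀ ξ₀ ∈ I, ∀ ξ ∈ I,
      G ξ = G ξ₀ * Real.exp (-2 * ∫ t in ξ₀..ξ, (x2 t + x3 t)) := by
    intro ξ₀ hξ₀ ξ hξ
    have hsub : Set.uIcc ξ₀ ξ ⊆ I := hI.uIcc_subset hξ₀ hξ
    rw [← intervalIntegral.integral_const_mul]
    refine eq_mul_exp_integral_of_hasDerivAt (fun t ht => ?_) fun t ht => hderiv t (hsub ht)
    exact (((h2 t (hsub ht)).continuousAt.add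
      (h3 t (hsub ht)).continuousAt).const_mul (-2)).continuousWithinAt
  refine ⟨hderiv, hexp, fun ξ₀ hξ₀ ξ hξ h => ?_⟩
  rw [hexp ξ₀ hξ₀ ξ hξ]
  exact mul_nonneg h (Real.exp_pos _).le
end

section
/- The planar vector field G(X₂,X₃) = ( (1 − X₂(2X₂+X₃))(1 − X₂² − X₃²), −X₃(2X₂+X₃)(1 − X₂² − X₃²) ) has zero set exactly equal to the union of the unit circle {(X₂,X₃): X₂² + X₃² = 1} and the two points (1/√2, 0) and (−1/√2, 0). In particular, every point of the unit circle at infinity is a critical point of the compactified system. -/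
/-- The zero set of the Poincaré-compactified massless-scalar-field vector field
`G(X₂,X₃) = ((1 − X₂(2X₂+X₃))(1 − X₂² − X₃²), −X₃(2X₂+X₃)(1 − X₂² − X₃²))`
is exactly the union of the unit circle with the two points `(±1/√2, 0)`. -/
theorem stmt3 (p : ℝ × ℝ) :
    ((1 - p.1 * (2 * p.1 + p.2)) * (1 - p.1 ^ 2 - p.2 ^ 2) = 0 ∧
      -p.2 * (2 * p.1 + p.2) * (1 - p.1 ^ 2 - p.2 ^ 2) = 0) ↔
      (p.1 ^ 2 + p.2 ^ 2 = 1 ∨ p = (1 / Real.sqrt 2, 0) ∨ p = (-(1 / Real.sqrt 2), 0)) := by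
  obtain ⟨x, y⟩ := p
  have hs : (1 / Real.sqrt 2) ^ 2 = 1 / 2 := by
    rw [div_pow, one_pow, Real.sq_sqrt zero_le_two]
  simp only [Prod.mk.injEq]
  generalize 1 / Real.sqrt 2 = r at hs ⊢
  constructor
  · rintro ⟨h₁, h₂⟩
    rcases mul_eq_zero.mp h₁ with hx | hc
    · rcases mul_eq_zero.mp h₂ with hy | hc
      · have hxy : 2 * x + y ≠ 0 := by
          intro h
          simp [h] at hx
        have hy₀ : y = 0 := neg_eq_zero.mp ((mul_eq_zero.mp hy).resolve_right hxy)
        subst hy₀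
        have hsq : x ^ 2 = r ^ 2 := by linarith
        rcases sq_eq_sq_iff_eq_or_eq_neg.mp hsq with h | h
        · exact Or.inr (Or.inl ⟨h, rfl⟩)
        · exact Or.inr (Or.inr ⟨h, rfl⟩)
      · left; linarith
    · left; linarith
  · rintro (h | ⟨rfl, rfl⟩ | ⟨rfl, rfl⟩)
    · have hc : 1 - x ^ 2 - y ^ 2 = 0 := by linarith
      simp [hc]
    all_goals
      refine ⟨mul_eq_zero_of_left ?_ _, by ring⟩
      linarith
end

section
/- Let ε ∈ {−1, 1}, let f: ℝ → ℝ, and let (x₁,x₂,x₃,y₁,y₂,λ): I → ℝ⁶ be a differentiable solution of the system x₁' = (2/3)ε y₁²(x₂−x₃) − x₁x₂; x₂' = (3x₁ − 4ε y₁² − 6y₂)/6; x₃' = −x₃(x₂+x₃) − 3y₂; y₁' = −y₁(x₂+x₃) − (3ελ y₂)/√2; y₂' = y₂(2x₂ − √2 λ y₁); λ' = −√2 f(λ) y₁. Define G₁ = x₂² + 2x₂x₃ − ε y₁² + 3y₂ − 1 and G₂ = 3x₁ − 6x₂x₃ + 2ε y₁² − 6y₂ along the solution. Then G₁' = (x₂+x₃)G₂/3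 and G₂' = −(x₂+x₃)G₂ identically on I; consequently, if G₁(ξ₀) = G₂(ξ₀) = 0 at some ξ₀ ∈ I, then G₁ ≡ 0 and G₂ ≡ 0 on all of I (the Gauss and electric-Weyl constraints are conserved by the flow). -/
open Set in
/-- A solution of a homogeneous linear scalar ODE with continuous coefficient on an interval
vanishes identically as soon as it vanishes at one point. -/
theorem eq_zero_of_hasDerivAt_mul_self {I : Set ℝ} (hI : I.OrdConnected) {a g : ℝ → ℝ}
    (ha : ContinuousOn a I) (hg : ∀ t ∈ I, HasDerivAt g (a t * g t) t)
    {t₀ : ℝ} (ht₀ : t₀ ∈ I) (h₀ : g t₀ = 0) {t : ℝ} (ht : t ∈ I) : g t = 0 := by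
  have hsub : uIcc t₀ t ⊆ I := hI.uIcc_subset ht₀ ht
  obtain ⟨C, hC⟩ := isCompact_uIcc.exists_bound_of_continuousOn (ha.mono hsub)
  have hlip : ∀ s ∈ uIcc t₀ t, LipschitzOnWith C.toNNReal (fun x => a s * x) univ := by
    refine fun s hs => (LipschitzWith.of_dist_le_mul fun x y => ?_).lipschitzOnWith
    rw [Real.dist_eq, Real.dist_eq, ← mul_sub, abs_mul]
    exact mul_le_mul_of_nonneg_right ((hC s hs).trans (Real.le_coe_toNNReal C)) (abs_nonneg _)
  have hzero : ∀ s, HasDerivAt (fun _ : ℝ => (0 : ℝ)) (a s * 0) s := fun s => by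
    simpa using hasDerivAt_const s (0 : ℝ)
  rcases le_total t₀ t with h | h
  · rw [uIcc_of_le h] at hsub hlip
    exact ODE_solution_unique_of_mem_Icc_right (v := fun s x => a s * x) (s := fun _ => univ)
      (fun s hs => hlip s (Ico_subset_Icc_self hs))
      (fun s hs => (hg s (hsub hs)).continuousAt.continuousWithinAt)
      (fun s hs => (hg s (hsub (Ico_subset_Icc_self hs))).hasDerivWithinAt)
      (fun _ _ => mem_univ _) continuousOn_const
      (fun s _ => (hzero s).hasDerivWithinAt) (fun _ _ => mem_univ _) h₀ (right_mem_Icc.2 h)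
  · rw [uIcc_of_ge h] at hsub hlip
    exact ODE_solution_unique_of_mem_Icc_left (v := fun s x => a s * x) (s := fun _ => univ)
      (fun s hs => hlip s (Ioc_subset_Icc_self hs))
      (fun s hs => (hg s (hsub hs)).continuousAt.continuousWithinAt)
      (fun s hs => (hg s (hsub (Ioc_subset_Icc_self hs))).hasDerivWithinAt)
      (fun _ _ => mem_univ _) continuousOn_const
      (fun s _ => (hzero s).hasDerivWithinAt) (fun _ _ => mem_univ _) h₀ (left_mem_Icc.2 h)

/-- Along any differentiable solution of the full six-dimensional system (with
`ε = ±1` and `f` encoding the potential), the constraint functions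
`G₁ = x₂² + 2x₂x₃ − ε y₁² + 3y₂ − 1` and `G₂ = 3x₁ − 6x₂x₃ + 2ε y₁² − 6y₂`
satisfy `G₁' = (x₂+x₃)G₂/3` and `G₂' = −(x₂+x₃)G₂`; consequently, if both vanish
at some `ξ₀ ∈ I`, they vanish identically on `I` (the Gauss and electric-Weyl
constraints are conserved by the flow). -/
theorem stmt6 (e : ℝ) (he : e = 1 ∨ e = -1) (f : ℝ → ℝ)
    (I : Set ℝ) (hI : I.OrdConnected)
    (x1 x2 x3 y1 y2 lam : ℝ → ℝ)
    (h1 : ∀ ξ ∈ I, HasDerivAt x1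
      (2 / 3 * e * (y1 ξ) ^ 2 * (x2 ξ - x3 ξ) - x1 ξ * x2 ξ) ξ)
    (h2 : ∀ ξ ∈ I, HasDerivAt x2
      ((3 * x1 ξ - 4 * e * (y1 ξ) ^ 2 - 6 * y2 ξ) / 6) ξ)
    (h3 : ∀ ξ ∈ I, HasDerivAt x3
      (-(x3 ξ) * (x2 ξ + x3 ξ) - 3 * y2 ξ) ξ)
    (h4 : ∀ ξ ∈ I, HasDerivAt y1
      (-(y1 ξ) * (x2 ξ + x3 ξ) - 3 * e * lam ξ * y2 ξ / Real.sqrt 2) ξ)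
    (h5 : ∀ ξ ∈ I, HasDerivAt y2
      (y2 ξ * (2 * x2 ξ - Real.sqrt 2 * lam ξ * y1 ξ)) ξ)
    (h6 : ∀ ξ ∈ I, HasDerivAt lam (-(Real.sqrt 2) * f (lam ξ) * y1 ξ) ξ)
    (G1 G2 : ℝ → ℝ)
    (hG1 : ∀ ξ, G1 ξ = (x2 ξ) ^ 2 + 2 * x2 ξ * x3 ξ - e * (y1 ξ) ^ 2 + 3 * y2 ξ - 1)
    (hG2 : ∀ ξ, G2 ξ = 3 * x1 ξ - 6 * x2 ξ * x3 ξ + 2 * e * (y1 ξ) ^ 2 - 6 * y2 ξ) :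
    (∀ ξ ∈ I, HasDerivAt G1 ((x2 ξ + x3 ξ) * G2 ξ / 3) ξ) ∧
    (∀ ξ ∈ I, HasDerivAt G2 (-(x2 ξ + x3 ξ) * G2 ξ) ξ) ∧
    (∀ ξ₀ ∈ I, G1 ξ₀ = 0 → G2 ξ₀ = 0 → ∀ ξ ∈ I, G1 ξ = 0 ∧ G2 ξ = 0) := by
  have he2 : e ^ 2 = 1 := by rcases he with rfl | rfl <;> norm_num
  have hs : Real.sqrt 2 ^ 2 = 2 := Real.sq_sqrt zero_le_two
  have hdiv : ∀ u : ℝ, u / Real.sqrt 2 = u * Real.sqrt 2 / 2 := fun u => by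
    field_simp
    rw [hs]
  have hd1 : ∀ ξ ∈ I, HasDerivAt G1 ((x2 ξ + x3 ξ) * G2 ξ / 3) ξ := by
    intro ξ hξ
    rw [funext hG1]
    refine ((((((h2 ξ hξ).pow 2).add (((h2 ξ hξ).const_mul 2).mul (h3 ξ hξ))).sub
      (((h4 ξ hξ).pow 2).const_mul e)).add ((h5 ξ hξ).const_mul 3)).sub_const 1).congr_deriv ?_
    rw [hG2, hdiv]
    push_cast
    linear_combination (3 * Real.sqrt 2 * lam ξ * y1 ξ * y2 ξ) * he2
  have hd2 : ∀ ξ ∈ I, HasDerivAt G2 (-(x2 ξ + x3 ξ) * G2 ξ) ξ := by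
    intro ξ hξ
    rw [hG2, funext hG2]
    refine (((((h1 ξ hξ).const_mul 3).sub (((h2 ξ hξ).const_mul 6).mul (h3 ξ hξ))).add
      (((h4 ξ hξ).pow 2).const_mul (2 * e))).sub ((h5 ξ hξ).const_mul 6)).congr_deriv ?_
    rw [hdiv]
    push_cast
    linear_combination (-6 * Real.sqrt 2 * lam ξ * y1 ξ * y2 ξ) * he2
  refine ⟨hd1, hd2, fun ξ₀ hξ₀ hG1ξ₀ hG2ξ₀ => ?_⟩
  have hG2_zero : ∀ ξ ∈ I, G2 ξ = 0 := fun ξ hξ =>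
    eq_zero_of_hasDerivAt_mul_self hI (a := fun t => -(x2 t + x3 t))
      (fun t ht => ((h2 t ht).continuousAt.add (h3 t ht).continuousAt).neg.continuousWithinAt)
      hd2 hξ₀ hG2ξ₀ hξ
  have hd1_zero : ∀ ξ ∈ I, HasDerivAt G1 (0 * G1 ξ) ξ := fun ξ hξ => by
    simpa [hG2_zero ξ hξ] using hd1 ξ hξ
  exact fun ξ hξ => ⟨eq_zero_of_hasDerivAt_mul_self hI (a := fun _ => 0) continuousOn_const
    hd1_zero hξ₀ hG1ξ₀ hξ, hG2_zero ξ hξ⟩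
end

section
/- For every λ ∈ ℝ, the zeros of the vector field F_λ(x₂,x₃,y₁) = ( x₂x₃ − y₁², x₂² + x₂x₃ − x₃² − y₁² − 1, (λ/√2)(x₂² + 2x₂x₃ − y₁² − 1) − y₁(x₂+x₃) ) on ℝ³ that satisfy the positive-potential phase-space condition x₂² + 2x₂x₃ − y₁² ≤ 1 are exactly the two Minkowski points (1, 0, 0) and (−1, 0, 0). -/
/-- For every `λ ∈ ℝ`, the zeros of the exponential-potential vector field
`F_λ(x₂,x₃,y₁)` that satisfy the positive-potential phase-space condition
`x₂² + 2x₂x₃ − y₁² ≤ 1` are exactly the two Minkowski points `(±1, 0, 0)`. -/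
theorem stmt8 (lam : ℝ) (x2 x3 y1 : ℝ) :
    (x2 * x3 - y1 ^ 2 = 0 ∧
      x2 ^ 2 + x2 * x3 - x3 ^ 2 - y1 ^ 2 - 1 = 0 ∧
      lam / Real.sqrt 2 * (x2 ^ 2 + 2 * x2 * x3 - y1 ^ 2 - 1) - y1 * (x2 + x3) = 0 ∧
      x2 ^ 2 + 2 * x2 * x3 - y1 ^ 2 ≤ 1) ↔
      ((x2 = 1 ∧ x3 = 0 ∧ y1 = 0) ∨ (x2 = -1 ∧ x3 = 0 ∧ y1 = 0)) := by
  constructor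
  · rintro ⟨h1, h2, -, h4⟩
    have h3 : x3 = 0 := by exact pow_eq_zero_iff two_ne_zero |>.mp (by nlinarith [sq_nonneg x3, sq_nonneg y1])
    subst h3
    have hy : y1 = 0 := pow_eq_zero_iff two_ne_zero |>.mp (by linarith)
    subst hy
    have hx : x2 ^ 2 = 1 := by linarith
    simpa using hx
  · rintro (⟨rfl, rfl, rfl⟩ | ⟨rfl, rfl, rfl⟩) <;> norm_num
end

section
/- For every λ ∈ ℝ, the Jacobian matrix of the vector field F_λ(x₂,x₃,y₁) = ( x₂x₃ − y₁², x₂² + x₂x₃ − x₃² − y₁² − 1, (λ/√2)(x₂² + 2x₂x₃ − y₁² − 1) − y₁(x₂+x₃) ) at the zero (1,0,0) has characteristic polynomial (X − 2)(X + 1)², i.e. eigenvalues 2, −1, −1, and at the zero (−1,0,0) has characteristic polynomial (X + 2)(X − 1)², i.e. eigenvalues −2, 1, 1. In particular both Minkowski points are saddle points. -/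
open Polynomial

theorem fderiv_quadratic_apply (a b c₁ c₂ k d : ℝ) (p v : Fin 3 → ℝ) :
    fderiv ℝ (fun x : Fin 3 → ℝ => a * x 0 ^ 2 + b * (x 0 * x 1) + c₁ * x 1 ^ 2 + c₂ * x 2 ^ 2
      + k * (x 2 * (x 0 + x 1)) + d) p v =
    a * (2 * p 0 * v 0) + b * (p 0 * v 1 + p 1 * v 0) + c₁ * (2 * p 1 * v 1)
      + c₂ * (2 * p 2 * v 2) + k * (p 2 * (v 0 + v 1) + (p 0 + p 1) * v 2) := by
  have h (i : Fin 3) : HasFDerivAt (fun x : Fin 3 → ℝ => x i)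
      (ContinuousLinearMap.proj (R := ℝ) (φ := fun _ : Fin 3 => ℝ) i) p :=
    (ContinuousLinearMap.proj (R := ℝ) (φ := fun _ : Fin 3 => ℝ) i).hasFDerivAt
  have key := ((((((h 0).pow 2).const_mul a).add (((h 0).mul (h 1)).const_mul b)).add
    (((h 1).pow 2).const_mul c₁)).add (((h 2).pow 2).const_mul c₂)).add
    (((h 2).mul ((h 0).add (h 1))).const_mul k) |>.add_const d
  refine (congrArg (fun L => L v) key.fderiv).trans ?_
  simp
  ring

/-- The Jacobian matrix of the exponential-potential vector field at `(e, 0, 0)`. -/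
theorem jacobian_eq (m e : ℝ) (F : (Fin 3 → ℝ) → (Fin 3 → ℝ))
    (hF : ∀ x, F x =
      ![x 0 * x 1 - (x 2) ^ 2,
        (x 0) ^ 2 + x 0 * x 1 - (x 1) ^ 2 - (x 2) ^ 2 - 1,
        m * ((x 0) ^ 2 + 2 * x 0 * x 1 - (x 2) ^ 2 - 1) - x 2 * (x 0 + x 1)])
    (J : Matrix (Fin 3) (Fin 3) ℝ)
    (hJ : ∀ i j, J i j = fderiv ℝ (fun x => F x i) ![e, 0, 0] (Pi.single j 1)) :
    J = !![0, e, 0; 2 * e, e, 0; 2 * e * m, 2 * e * m, -e] := by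
  have h0 : (fun x => F x 0) = fun x : Fin 3 → ℝ => 0 * x 0 ^ 2 + 1 * (x 0 * x 1) + 0 * x 1 ^ 2
      + (-1) * x 2 ^ 2 + 0 * (x 2 * (x 0 + x 1)) + 0 := by
    funext x; simp [hF]; ring
  have h1 : (fun x => F x 1) = fun x : Fin 3 → ℝ => 1 * x 0 ^ 2 + 1 * (x 0 * x 1)
      + (-1) * x 1 ^ 2 + (-1) * x 2 ^ 2 + 0 * (x 2 * (x 0 + x 1)) + (-1) := by
    funext x; simp [hF]; ring
  have h2 : (fun x => F x 2) = fun x : Fin 3 → ℝ => m * x 0 ^ 2 + (2 * m) * (x 0 * x 1)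
      + 0 * x 1 ^ 2 + (-m) * x 2 ^ 2 + (-1) * (x 2 * (x 0 + x 1)) + (-m) := by
    funext x; simp [hF]; ring
  ext i j
  rw [hJ]
  fin_cases i
  · simp only [Fin.zero_eta, h0, fderiv_quadratic_apply]
    fin_cases j <;> simp
  · simp only [Fin.mk_one, h1, fderiv_quadratic_apply]
    fin_cases j <;> simp
  · simp only [Fin.reduceFinMk, h2, fderiv_quadratic_apply]
    fin_cases j <;> simp <;> ring

theorem charpoly_jacobian (m e : ℝ) :
    (!![0, e, 0; 2 * e, e, 0; 2 * e * m, 2 * e * m, -e] : Matrix (Fin 3) (Fin 3) ℝ).charpoly =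
      (X - C (2 * e)) * (X + C e) ^ 2 := by
  have h2 : (C 2 : ℝ[X]) = 2 := rfl
  simp [h2, Matrix.charpoly, Matrix.det_fin_three]
  ring

/-- For every `λ`, the Jacobian matrix of the exponential-potential vector field
`F_λ` at the Minkowski zero `(1,0,0)` has characteristic polynomial
`(X − 2)(X + 1)²` (eigenvalues `2, −1, −1`), and at `(−1,0,0)` it has
characteristic polynomial `(X + 2)(X − 1)²` (eigenvalues `−2, 1, 1`); both
Minkowski points are saddle points. -/
theorem stmt9 (lam : ℝ) (F : (Fin 3 → ℝ) → (Fin 3 → ℝ))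
    (hF : ∀ x, F x =
      ![x 0 * x 1 - (x 2) ^ 2,
        (x 0) ^ 2 + x 0 * x 1 - (x 1) ^ 2 - (x 2) ^ 2 - 1,
        lam / Real.sqrt 2 * ((x 0) ^ 2 + 2 * x 0 * x 1 - (x 2) ^ 2 - 1) - x 2 * (x 0 + x 1)])
    (Jp Jm : Matrix (Fin 3) (Fin 3) ℝ)
    (hJp : ∀ i j, Jp i j = fderiv ℝ (fun x => F x i) ![1, 0, 0] (Pi.single j 1))
    (hJm : ∀ i j, Jm i j = fderiv ℝ (fun x => F x i) ![-1, 0, 0] (Pi.single j 1)) :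
    Jp.charpoly = (X - C 2) * (X + C 1) ^ 2 ∧
    Jm.charpoly = (X + C 2) * (X - C 1) ^ 2 := by
  rw [jacobian_eq _ 1 F hF Jp hJp, jacobian_eq _ (-1) F hF Jm hJm, charpoly_jacobian,
    charpoly_jacobian]
  constructor
  · norm_num
  · simp [sub_eq_add_neg]
end

section
/- Let (θ, Y₁): I → ℝ² be a differentiable solution of the system θ' = −((cos θ − sin θ)/2)·[1 + 2Y₁² + cos(2θ) − 2 sin(2θ)], Y₁' = Y₁·((cos θ + sin θ)/2)·[1 + 2Y₁² + cos(2θ) − 2 sin(2θ)], and suppose cos θ(ξ) ≠ sin θ(ξ) for all ξ ∈ I. Then the quantity Y₁(ξ)/(cos θ(ξ) − sin θ(ξ)) is constant on I; equivalently, every orbit satisfies Y₁(θ) = c₁ (cos θ − sin θ) for some constant c₁. -/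
/-- A real function with zero derivative at every point of an order-connected set is constant on
that set. -/
theorem Set.OrdConnected.eq_of_hasDerivAt_zero {s : Set ℝ} (hs : s.OrdConnected) {f : ℝ → ℝ}
    (hf : ∀ x ∈ s, HasDerivAt f 0 x) {x y : ℝ} (hx : x ∈ s) (hy : y ∈ s) : f x = f y := by
  have h := hs.convex.norm_image_sub_le_of_norm_hasDerivWithin_le (C := 0)
    (fun z hz => (hf z hz).hasDerivWithinAt) (fun z _ => by simp) hy hx
  rwa [zero_mul, norm_le_zero_iff, sub_eq_zero] at h

/-- Along any differentiable solution of the system on the invariant surface `M`,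
`θ' = −((cos θ − sin θ)/2)[1 + 2Y₁² + cos 2θ − 2 sin 2θ]`,
`Y₁' = Y₁((cos θ + sin θ)/2)[1 + 2Y₁² + cos 2θ − 2 sin 2θ]`,
with `cos θ ≠ sin θ` on the interval `I`, the quantity `Y₁/(cos θ − sin θ)` is
constant on `I`; equivalently every orbit satisfies `Y₁ = c₁(cos θ − sin θ)`. -/
theorem stmt11 (I : Set ℝ) (hI : I.OrdConnected) (θ Y : ℝ → ℝ)
    (hθ : ∀ ξ ∈ I, HasDerivAt θ
      (-((Real.cos (θ ξ) - Real.sin (θ ξ)) / 2) *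
        (1 + 2 * (Y ξ) ^ 2 + Real.cos (2 * θ ξ) - 2 * Real.sin (2 * θ ξ))) ξ)
    (hY : ∀ ξ ∈ I, HasDerivAt Y
      (Y ξ * ((Real.cos (θ ξ) + Real.sin (θ ξ)) / 2) *
        (1 + 2 * (Y ξ) ^ 2 + Real.cos (2 * θ ξ) - 2 * Real.sin (2 * θ ξ))) ξ)
    (hne : ∀ ξ ∈ I, Real.cos (θ ξ) ≠ Real.sin (θ ξ)) :
    (∀ ξ₁ ∈ I, ∀ ξ₂ ∈ I,
      Y ξ₁ / (Real.cos (θ ξ₁) - Real.sin (θ ξ₁)) =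
        Y ξ₂ / (Real.cos (θ ξ₂) - Real.sin (θ ξ₂))) ∧
    (∃ c₁ : ℝ, ∀ ξ ∈ I, Y ξ = c₁ * (Real.cos (θ ξ) - Real.sin (θ ξ))) := by
  have hd : ∀ ξ ∈ I, Real.cos (θ ξ) - Real.sin (θ ξ) ≠ 0 := fun ξ hξ => sub_ne_zero.2 (hne ξ hξ)
  have hderiv : ∀ ξ ∈ I,
      HasDerivAt (fun ξ => Y ξ / (Real.cos (θ ξ) - Real.sin (θ ξ))) 0 ξ := by
    intro ξ hξ
    refine ((hY ξ hξ).fun_div ((hθ ξ hξ).cos.fun_sub (hθ ξ hξ).sin) (hd ξ hξ)).congr_deriv ?_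
    rw [div_eq_zero_iff]
    left
    ring
  have hconst : ∀ ξ₁ ∈ I, ∀ ξ₂ ∈ I,
      Y ξ₁ / (Real.cos (θ ξ₁) - Real.sin (θ ξ₁)) =
        Y ξ₂ / (Real.cos (θ ξ₂) - Real.sin (θ ξ₂)) :=
    fun _ h₁ _ h₂ => hI.eq_of_hasDerivAt_zero hderiv h₁ h₂
  refine ⟨hconst, ?_⟩
  rcases I.eq_empty_or_nonempty with rfl | ⟨ξ₀, h₀⟩
  · exact ⟨0, by simp⟩
  · exact ⟨Y ξ₀ / (Real.cos (θ ξ₀) - Real.sin (θ ξ₀)), fun ξ hξ =>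
      (div_eq_iff (hd ξ hξ)).1 (hconst ξ hξ ξ₀ h₀)⟩
end

section
/- Let f: ℝ → ℝ and consider the compactified four-dimensional vector field with components Ẋ₂ = −(λ/√2)X₂Y₁𝓘 + Y₁²(X₂(2X₂+X₃) − 1) − X₂X₃(X₂(3X₂+X₃) − 2), Ẋ₃ = −(λ/√2)X₃Y₁𝓘 − 3X₂²X₃² + 2X₂² − X₂X₃³ + X₃Y₁²(2X₂+X₃) + X₂X₃ + X₃² − 1, Ẏ₁ = (λ/√2)(1 − Y₁²)𝓘 − X₂Y₁(3X₂X₃ + X₃² + 1) + Y₁³(2X₂+X₃), λ̇ = −√2 Y₁ f(λ), where 𝓘 = 2X₂² + 2X₂X₃ + X₃² − 1. For every λ* ∈ ℝ with f(λ*) = 0, the point P(λ*) = ( √(2/(λ*²+4)), √(2/(λ*²+4)), λ*/√(λ*²+4), λ* ) is a zero of this vector field; moreover P(λ*) always satisfies X₂² + X₃² + Y₁² = 1, and it satisfies the phase-space condition 2X₂² + 2X₂X₃ + X₃² ≤ 1 if and only if λ*² ≥ 6. -/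
/-- For every root `λ*` of `f`, the point
`P(λ*) = (√(2/(λ*²+4)), √(2/(λ*²+4)), λ*/√(λ*²+4), λ*)` is a zero of the
compactified four-dimensional vector field; it always lies on the unit sphere
`X₂² + X₃² + Y₁² = 1`, and it satisfies the phase-space condition
`2X₂² + 2X₂X₃ + X₃² ≤ 1` if and only if `λ*² ≥ 6`. -/
theorem stmt12 (f : ℝ → ℝ) (lam : ℝ) (hroot : f lam = 0) (X2 X3 Y1 : ℝ)
    (hX2 : X2 = Real.sqrt (2 / (lam ^ 2 + 4)))
    (hX3 : X3 = Real.sqrt (2 / (lam ^ 2 + 4)))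
    (hY1 : Y1 = lam / Real.sqrt (lam ^ 2 + 4)) :
    (-(lam / Real.sqrt 2) * X2 * Y1 * (2 * X2 ^ 2 + 2 * X2 * X3 + X3 ^ 2 - 1)
        + Y1 ^ 2 * (X2 * (2 * X2 + X3) - 1)
        - X2 * X3 * (X2 * (3 * X2 + X3) - 2) = 0 ∧
      -(lam / Real.sqrt 2) * X3 * Y1 * (2 * X2 ^ 2 + 2 * X2 * X3 + X3 ^ 2 - 1)
        - 3 * X2 ^ 2 * X3 ^ 2 + 2 * X2 ^ 2 - X2 * X3 ^ 3
        + X3 * Y1 ^ 2 * (2 * X2 + X3) + X2 * X3 + X3 ^ 2 - 1 = 0 ∧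
      (lam / Real.sqrt 2) * (1 - Y1 ^ 2) * (2 * X2 ^ 2 + 2 * X2 * X3 + X3 ^ 2 - 1)
        - X2 * Y1 * (3 * X2 * X3 + X3 ^ 2 + 1) + Y1 ^ 3 * (2 * X2 + X3) = 0 ∧
      -(Real.sqrt 2) * Y1 * f lam = 0) ∧
    X2 ^ 2 + X3 ^ 2 + Y1 ^ 2 = 1 ∧
    (2 * X2 ^ 2 + 2 * X2 * X3 + X3 ^ 2 ≤ 1 ↔ 6 ≤ lam ^ 2) := by
  have hpos : 0 < lam ^ 2 + 4 := by positivity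
  have hs : Real.sqrt (lam ^ 2 + 4) ≠ 0 := (Real.sqrt_pos.mpr hpos).ne'
  have h2 : Real.sqrt 2 ≠ 0 := by positivity
  obtain rfl : X3 = X2 := hX3.trans hX2.symm
  have hXsq : X3 ^ 2 = 2 / (lam ^ 2 + 4) := by
    rw [hX2, Real.sq_sqrt (by positivity)]
  have hYsq : Y1 ^ 2 = 1 - 2 * X3 ^ 2 := by
    rw [hXsq, hY1, div_pow, Real.sq_sqrt hpos.le]
    field_simp
    ring
  have hkX : lam / Real.sqrt 2 * X3 = Y1 := by
    rw [hX2, hY1, Real.sqrt_div zero_le_two]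
    field_simp
  generalize lam / Real.sqrt 2 = k at hkX ⊢
  refine ⟨⟨?_, ?_, ?_, by rw [hroot, mul_zero]⟩, by linear_combination hYsq, ?_⟩
  · linear_combination (-Y1 * (5 * X3 ^ 2 - 1)) * hkX - 2 * X3 ^ 2 * hYsq
  · linear_combination (-Y1 * (5 * X3 ^ 2 - 1)) * hkX + (1 - 2 * X3 ^ 2) * hYsq
  · linear_combination (2 * X3 * (5 * X3 ^ 2 - 1)) * hkX
      + (3 * X3 * Y1 - k * (5 * X3 ^ 2 - 1)) * hYsq
  · have hI : 2 * X3 ^ 2 + 2 * X3 * X3 + X3 ^ 2 = 10 / (lam ^ 2 + 4) := by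
      linear_combination 5 * hXsq
    rw [hI, div_le_one hpos]
    constructor <;> intro h <;> linarith
end

section
/- Let λ ∈ ℝ and let (X₂,X₃,Y₁): I → ℝ³ be a differentiable solution of the compactified exponential-potential system Ẋ₂ = −(λ/√2)X₂Y₁𝓘 + Y₁²(X₂(2X₂+X₃) − 1) − X₂X₃(X₂(3X₂+X₃) − 2), Ẋ₃ = −(λ/√2)X₃Y₁𝓘 − 3X₂²X₃² + 2X₂² − X₂X₃³ + X₃Y₁²(2X₂+X₃) + X₂X₃ + X₃² − 1, Ẏ₁ = (λ/√2)(1 − Y₁²)𝓘 − X₂Y₁(3X₂X₃ + X₃² + 1) + Y₁³(2X₂+X₃), with 𝓘 = 2X₂² + 2X₂X₃ + X₃² − 1, such that |X₂(ξ)| < 1 and X₂(ξ) + X₃(ξ) − √(1 − X₂(ξ)²) ≠ 0 on I. Then the function h = (X₂ + X₃ + √(1 − X₂²))/(X₂ + X₃ − √(1 − X₂²)) satisfies h' = −A·h along the solution, where A = [ 2(Y₁² + 1) − (X₂ + X₃)(2X₂ + √2 λ Y₁) ] / √(1 − X₂²). -/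
/-- If `x' = p`, `z' = q` and the algebraic compatibility relation holds, then the quotient
`(x + z + √(1 - x²)) / (x + z - √(1 - x²))` has logarithmic derivative `-B / √(1 - x²)`. -/
theorem hasDerivAt_boundary_ratio {x z : ℝ → ℝ} {p q B t : ℝ}
    (hx : HasDerivAt x p t) (hz : HasDerivAt z q t) (hpos : 0 < 1 - x t ^ 2)
    (hd : x t + z t - Real.sqrt (1 - x t ^ 2) ≠ 0)
    (key : 2 * (x t * p * (x t + z t) + (p + q) * (1 - x t ^ 2)) =
      B * ((x t + z t) ^ 2 - (1 - x t ^ 2))) :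
    HasDerivAt
      (fun τ => (x τ + z τ + Real.sqrt (1 - x τ ^ 2)) / (x τ + z τ - Real.sqrt (1 - x τ ^ 2)))
      (-(B / Real.sqrt (1 - x t ^ 2)) * ((x t + z t + Real.sqrt (1 - x t ^ 2)) /
        (x t + z t - Real.sqrt (1 - x t ^ 2)))) t := by
  have hs := ((hx.fun_pow 2).const_sub 1).sqrt hpos.ne'
  refine (((hx.fun_add hz).fun_add hs).fun_div ((hx.fun_add hz).fun_sub hs) hd).congr_deriv ?_
  have hs0 : Real.sqrt (1 - x t ^ 2) ≠ 0 := (Real.sqrt_pos.mpr hpos).ne'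
  have hs2 : Real.sqrt (1 - x t ^ 2) ^ 2 = 1 - x t ^ 2 := Real.sq_sqrt hpos.le
  generalize Real.sqrt (1 - x t ^ 2) = s at *
  norm_num
  field_simp
  linear_combination -key - (2 * (p + q) + B) * hs2


/-- Along any differentiable solution of the compactified exponential-potential
system with `|X₂| < 1` and `X₂ + X₃ − √(1 − X₂²) ≠ 0` on the interval `I`, the
function `h = (X₂ + X₃ + √(1 − X₂²))/(X₂ + X₃ − √(1 − X₂²))` satisfies
`h' = −A·h`, where
`A = [2(Y₁² + 1) − (X₂ + X₃)(2X₂ + √2 λ Y₁)]/√(1 − X₂²)`. -/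
theorem stmt13 (lam : ℝ) (I : Set ℝ) (X2 X3 Y1 : ℝ → ℝ)
    (h2 : ∀ ξ ∈ I, HasDerivAt X2
      (-(lam / Real.sqrt 2) * X2 ξ * Y1 ξ *
          (2 * (X2 ξ) ^ 2 + 2 * X2 ξ * X3 ξ + (X3 ξ) ^ 2 - 1)
        + (Y1 ξ) ^ 2 * (X2 ξ * (2 * X2 ξ + X3 ξ) - 1)
        - X2 ξ * X3 ξ * (X2 ξ * (3 * X2 ξ + X3 ξ) - 2)) ξ)
    (h3 : ∀ ξ ∈ I, HasDerivAt X3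
      (-(lam / Real.sqrt 2) * X3 ξ * Y1 ξ *
          (2 * (X2 ξ) ^ 2 + 2 * X2 ξ * X3 ξ + (X3 ξ) ^ 2 - 1)
        - 3 * (X2 ξ) ^ 2 * (X3 ξ) ^ 2 + 2 * (X2 ξ) ^ 2 - X2 ξ * (X3 ξ) ^ 3
        + X3 ξ * (Y1 ξ) ^ 2 * (2 * X2 ξ + X3 ξ) + X2 ξ * X3 ξ + (X3 ξ) ^ 2 - 1) ξ)
    (h1 : ∀ ξ ∈ I, HasDerivAt Y1
      ((lam / Real.sqrt 2) * (1 - (Y1 ξ) ^ 2) *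
          (2 * (X2 ξ) ^ 2 + 2 * X2 ξ * X3 ξ + (X3 ξ) ^ 2 - 1)
        - X2 ξ * Y1 ξ * (3 * X2 ξ * X3 ξ + (X3 ξ) ^ 2 + 1)
        + (Y1 ξ) ^ 3 * (2 * X2 ξ + X3 ξ)) ξ)
    (hlt : ∀ ξ ∈ I, |X2 ξ| < 1)
    (hne : ∀ ξ ∈ I, X2 ξ + X3 ξ - Real.sqrt (1 - (X2 ξ) ^ 2) ≠ 0)
    (h A : ℝ → ℝ)
    (hh : ∀ ξ, h ξ = (X2 ξ + X3 ξ + Real.sqrt (1 - (X2 ξ) ^ 2)) /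
        (X2 ξ + X3 ξ - Real.sqrt (1 - (X2 ξ) ^ 2)))
    (hA : ∀ ξ, A ξ = (2 * ((Y1 ξ) ^ 2 + 1)
        - (X2 ξ + X3 ξ) * (2 * X2 ξ + Real.sqrt 2 * lam * Y1 ξ)) /
        Real.sqrt (1 - (X2 ξ) ^ 2)) :
    ∀ ξ ∈ I, HasDerivAt h (-(A ξ) * h ξ) ξ := by
  intro ξ hξ
  have hpos : 0 < 1 - X2 ξ ^ 2 := sub_pos.mpr ((sq_lt_one_iff_abs_lt_one _).mpr (hlt ξ hξ))
  have hlam : Real.sqrt 2 * lam = 2 * (lam / Real.sqrt 2) := by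
    have h22 : Real.sqrt 2 ^ 2 = 2 := Real.sq_sqrt (by norm_num)
    field_simp
    rw [h22, mul_comm]
  rw [hA, hh, funext hh, hlam]
  refine hasDerivAt_boundary_ratio (h2 ξ hξ) (h3 ξ hξ) hpos (hne ξ hξ) ?_
  ring
end

section
/- Let f: ℝ → ℝ and consider the four-dimensional vector field on ℝ⁴ given by x₂' = x₂x₃ − y₁², x₃' = x₂² + x₂x₃ − x₃² − y₁² − 1, y₁' = (λ/√2)(x₂² + 2x₂x₃ − y₁² − 1) − y₁(x₂+x₃), λ' = −√2 f(λ) y₁. The zeros of this vector field that satisfy the positive-potential phase-space condition x₂² + 2x₂x₃ − y₁² ≤ 1 are exactly the points of the two Minkowski critical lines {(1, 0, 0, λ): λ ∈ ℝ} and {(−1, 0, 0, λ): λ ∈ ℝ}. -/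
/-- For any `f : ℝ → ℝ`, the zeros of the four-dimensional vector field for a
canonical scalar field with arbitrary positive potential that satisfy the
phase-space condition `x₂² + 2x₂x₃ − y₁² ≤ 1` are exactly the points of the two
Minkowski critical lines `(±1, 0, 0, λ)`, `λ ∈ ℝ`. -/
theorem stmt14 (f : ℝ → ℝ) (x2 x3 y1 lam : ℝ) :
    (x2 * x3 - y1 ^ 2 = 0 ∧
      x2 ^ 2 + x2 * x3 - x3 ^ 2 - y1 ^ 2 - 1 = 0 ∧
      lam / Real.sqrt 2 * (x2 ^ 2 + 2 * x2 * x3 - y1 ^ 2 - 1) - y1 * (x2 + x3) = 0 ∧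
      -(Real.sqrt 2) * f lam * y1 = 0 ∧
      x2 ^ 2 + 2 * x2 * x3 - y1 ^ 2 ≤ 1) ↔
      ((x2 = 1 ∧ x3 = 0 ∧ y1 = 0) ∨ (x2 = -1 ∧ x3 = 0 ∧ y1 = 0)) := by
  constructor
  · rintro ⟨h1, h2, -, -, h5⟩
    have hx3 : x3 = 0 := pow_eq_zero_iff two_ne_zero |>.mp (by nlinarith [sq_nonneg x3, sq_nonneg y1])
    have hy1 : y1 = 0 := pow_eq_zero_iff two_ne_zero |>.mp (by nlinarith [sq_nonneg x3, sq_nonneg y1])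
    subst hx3 hy1
    have hx2 : x2 ^ 2 = 1 := by linarith
    simpa using hx2
  · rintro (⟨rfl, rfl, rfl⟩ | ⟨rfl, rfl, rfl⟩) <;> norm_num
end

section
/- Let f: ℝ → ℝ be differentiable and let λ_c ∈ ℝ. The Jacobian matrix at the point (1, 0, 0, λ_c) of the vector field x₂' = x₂x₃ − y₁², x₃' = x₂² + x₂x₃ − x₃² − y₁² − 1, y₁' = (λ/√2)(x₂² + 2x₂x₃ − y₁² − 1) − y₁(x₂+x₃), λ' = −√2 f(λ) y₁ has characteristic polynomial X(X − 2)(X + 1)², i.e. eigenvalues 2, −1, −1, 0. In particular every point of the Minkowski critical line is a non-hyperbolic saddle. -/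
open Polynomial

/-- The characteristic polynomial of the Jacobian, whatever the entries `a`, `b`, `c` coupling the
diagonal blocks. -/
theorem charpoly_minkowski_jacobian {R : Type*} [CommRing R] (a b c : R) :
    (!![0, 1, 0, 0; 2, 1, 0, 0; a, b, -1, 0; 0, 0, c, 0] : Matrix (Fin 4) (Fin 4) R).charpoly =
      X * (X - C 2) * (X + C 1) ^ 2 := by
  simp [Matrix.charpoly, Matrix.charmatrix, Matrix.det_succ_row_zero, Fin.sum_univ_succ,
    Fin.succAbove]
  rw [show (C 2 : R[X]) = 2 from map_ofNat C 2]
  ring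

/-- For differentiable `f` and any `λ_c`, the Jacobian matrix of the
four-dimensional general-potential vector field at the Minkowski critical point
`(1, 0, 0, λ_c)` has characteristic polynomial `X(X − 2)(X + 1)²`
(eigenvalues `2, −1, −1, 0`): every point of the Minkowski critical line is a
non-hyperbolic saddle. -/
theorem stmt15 (f : ℝ → ℝ) (hf : Differentiable ℝ f) (lc : ℝ)
    (F : (Fin 4 → ℝ) → (Fin 4 → ℝ))
    (hF : ∀ x, F x =
      ![x 0 * x 1 - (x 2) ^ 2,
        (x 0) ^ 2 + x 0 * x 1 - (x 1) ^ 2 - (x 2) ^ 2 - 1,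
        x 3 / Real.sqrt 2 * ((x 0) ^ 2 + 2 * x 0 * x 1 - (x 2) ^ 2 - 1) - x 2 * (x 0 + x 1),
        -(Real.sqrt 2) * f (x 3) * x 2])
    (J : Matrix (Fin 4) (Fin 4) ℝ)
    (hJ : ∀ i j, J i j = fderiv ℝ (fun x => F x i) ![1, 0, 0, lc] (Pi.single j 1)) :
    J.charpoly = X * (X - C 2) * (X + C 1) ^ 2 := by
  have hp (i : Fin 4) : HasFDerivAt (fun x : Fin 4 → ℝ => x i)
      (ContinuousLinearMap.proj (R := ℝ) (φ := fun _ : Fin 4 => ℝ) i) ![1, 0, 0, lc] :=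
    hasFDerivAt_apply i _
  have hJac : J = !![0, 1, 0, 0; 2, 1, 0, 0; lc / √2 * 2, lc / √2 * 2, -1, 0;
      0, 0, -√2 * f lc, 0] := by
    have h0 := ((hp 0).mul (hp 1)).sub ((hp 2).pow 2)
    have h1 := (((((hp 0).pow 2).add ((hp 0).mul (hp 1))).sub ((hp 1).pow 2)).sub
      ((hp 2).pow 2)).sub_const 1
    have h2 := (((hp 3).mul_const (√2)⁻¹).mul
      (((((hp 0).pow 2).add (((hp 0).const_mul 2).mul (hp 1))).sub ((hp 2).pow 2)).sub_const
        1)).sub ((hp 2).mul ((hp 0).add (hp 1)))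
    have h3 := (((hf lc).hasDerivAt.comp_hasFDerivAt (![1, 0, 0, lc] : Fin 4 → ℝ)
      (hp 3)).const_mul (-√2)).mul (hp 2)
    have e0 : (fun x => F x 0) = _ := funext fun x => congrFun (hF x) 0
    have e1 : (fun x => F x 1) = _ := funext fun x => congrFun (hF x) 1
    have e2 : (fun x => F x 2) = _ := funext fun x => congrFun (hF x) 2
    have e3 : (fun x => F x 3) = _ := funext fun x => congrFun (hF x) 3
    have d0 := (h0.congr_of_eventuallyEq (.of_eq e0)).fderiv
    have d1 := (h1.congr_of_eventuallyEq (.of_eq e1)).fderiv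
    have d2 := (h2.congr_of_eventuallyEq (.of_eq e2)).fderiv
    have d3 := (h3.congr_of_eventuallyEq (.of_eq e3)).fderiv
    ext i j
    rw [hJ]
    fin_cases i
    · simp only [Fin.zero_eta, d0]
      fin_cases j <;> simp
    · simp only [Fin.mk_one, d1]
      fin_cases j <;> simp
    · simp only [Fin.reduceFinMk, d2]
      fin_cases j <;> simp [div_eq_mul_inv]
    · simp only [Fin.reduceFinMk, d3]
      fin_cases j <;> simp
  rw [hJac, charpoly_minkowski_jacobian]
end

section
/- Let f: ℝ → ℝ and let λ* ∈ ℝ satisfy f(λ*) = 0 and λ*⁴ > 4. Then the point Q(λ*) = ( λ*²/√(λ*⁴−4), 2/√(λ*⁴−4), √2 λ*/√(λ*⁴−4), λ* ) is a zero of the vector field x₂' = x₂x₃ − y₁², x₃' = x₂² + x₂x₃ − x₃² − y₁² − 1, y₁' = (λ/√2)(x₂² + 2x₂x₃ − y₁² − 1) − y₁(x₂+x₃), λ' = −√2 f(λ) y₁, and at Q(λ*) one has x₂² + 2x₂x₃ − y₁² > 1; that is, Q(λ*) lies strictly in the negative-potential region of phase space (it exists only for V(ψ) < 0). -/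
/-- If `f(λ*) = 0` and `λ*⁴ > 4`, then
`Q(λ*) = (λ*²/√(λ*⁴−4), 2/√(λ*⁴−4), √2 λ*/√(λ*⁴−4), λ*)` is a zero of the
four-dimensional general-potential vector field, and at `Q(λ*)` one has
`x₂² + 2x₂x₃ − y₁² > 1`, i.e. `Q(λ*)` lies strictly in the negative-potential
region of phase space. -/
theorem stmt16 (f : ℝ → ℝ) (lam : ℝ) (hroot : f lam = 0) (hlam : 4 < lam ^ 4)
    (x2 x3 y1 : ℝ)
    (hx2 : x2 = lam ^ 2 / Real.sqrt (lam ^ 4 - 4))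
    (hx3 : x3 = 2 / Real.sqrt (lam ^ 4 - 4))
    (hy1 : y1 = Real.sqrt 2 * lam / Real.sqrt (lam ^ 4 - 4)) :
    (x2 * x3 - y1 ^ 2 = 0 ∧
      x2 ^ 2 + x2 * x3 - x3 ^ 2 - y1 ^ 2 - 1 = 0 ∧
      lam / Real.sqrt 2 * (x2 ^ 2 + 2 * x2 * x3 - y1 ^ 2 - 1) - y1 * (x2 + x3) = 0 ∧
      -(Real.sqrt 2) * f lam * y1 = 0) ∧
    1 < x2 ^ 2 + 2 * x2 * x3 - y1 ^ 2 := by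
  have hS : 0 < Real.sqrt (lam ^ 4 - 4) := Real.sqrt_pos.mpr (by linarith)
  have hS2 : Real.sqrt (lam ^ 4 - 4) ^ 2 = lam ^ 4 - 4 := Real.sq_sqrt (by linarith)
  have hr : 0 < Real.sqrt 2 := by positivity
  have hr2 : Real.sqrt 2 ^ 2 = 2 := Real.sq_sqrt (by norm_num)
  have hx2_nonneg : 0 ≤ x2 := by rw [hx2]; positivity
  have hx3_pos : 0 < x3 := by rw [hx3]; positivity
  have hy1_sq : x2 * x3 = y1 ^ 2 := by
    rw [hx2, hx3, hy1, div_pow, mul_pow, hr2]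
    field_simp
  have hx_sq : x2 ^ 2 - x3 ^ 2 = 1 := by
    rw [hx2, hx3, div_pow, div_pow, hS2, ← sub_div, div_eq_one_iff_eq (by linarith)]
    ring
  have hy1_eq : lam / Real.sqrt 2 * x3 = y1 := by
    rw [hx3, hy1]
    field_simp
    rw [hr2]
  refine ⟨⟨by linarith, by linarith, ?_, by rw [hroot]; ring⟩, by nlinarith⟩
  linear_combination (x2 + x3) * hy1_eq + lam / Real.sqrt 2 * (hx_sq + hy1_sq)
end

section
/- Let f: ℝ → ℝ be differentiable and let λ* ∈ ℝ satisfy f(λ*) = 0 and λ*⁴ > 4. Then the Jacobian matrix at the zero Q(λ*) = ( λ*²/√(λ*⁴−4), 2/√(λ*⁴−4), √2 λ*/√(λ*⁴−4), λ* ) of the vector field x₂' = x₂x₃ − y₁², x₃' = x₂² + x₂x₃ − x₃² − y₁² − 1, y₁' = (λ/√2)(x₂² + 2x₂x₃ − y₁² − 1) − y₁(x₂+x₃), λ' = −√2 f(λ) y₁ has characteristic polynomial ( X + (λ*²+2)/√(λ*⁴−4) ) · ( X + 2λ* f'(λ*)/√(λ*⁴−4) ) · ( X² + ((λ*²+2)/√(λ*⁴−4))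 X + 2 ); equivalently its eigenvalues are −(λ*²+2)/√(λ*⁴−4), −(2+λ*² ± √(−7λ*⁴+4λ*²+36))/(2√(λ*⁴−4)), and −2λ* f'(λ*)/√(λ*⁴−4). -/
open Polynomial

/-- The characteristic polynomial of the Jacobian matrix of the vector field at `(a, b, c, λ)`,
with `k = λ / √2`, `e = √2 f'(λ) c` and `d` the entry that does not contribute. -/
theorem charpoly_of_jacobian_entries (a b c k d e : ℝ)
    (hkc : k * c = a) (hc : c ^ 2 = a * b) (hab : a ^ 2 - b ^ 2 = 1) :
    (!![b, a, -2 * c, 0;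
        2 * a + b, a - 2 * b, -2 * c, 0;
        2 * k * (a + b) - c, 2 * k * a - c, -3 * a - b, d;
        0, 0, 0, -e] : Matrix (Fin 4) (Fin 4) ℝ).charpoly =
      (X + C (a + b)) * (X + C e) * (X ^ 2 + C (a + b) * X + C 2) := by
  refine Polynomial.funext fun x => ?_
  rw [Matrix.eval_charpoly]
  simp [Matrix.det_succ_row_zero, Fin.sum_univ_succ, Fin.succAbove, Matrix.scalar_apply,
    Matrix.submatrix_apply]
  linear_combination (x + e) *
    ((4 * b * x + 8 * a * x + 8 * a * b + 8 * b ^ 2 + 8 * a ^ 2) * hkc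
      - 4 * (x + a + b) * hc + 2 * (x + a + b) * hab)

/-- For differentiable `f` with `f(λ*) = 0` and `λ*⁴ > 4`, the Jacobian matrix of
the four-dimensional general-potential vector field at the zero
`Q(λ*) = (λ*²/√(λ*⁴−4), 2/√(λ*⁴−4), √2 λ*/√(λ*⁴−4), λ*)` has characteristic
polynomial `(X + (λ*²+2)/√(λ*⁴−4))(X + 2λ* f'(λ*)/√(λ*⁴−4))(X² + ((λ*²+2)/√(λ*⁴−4))X + 2)`. -/
theorem stmt17 (f : ℝ → ℝ) (hf : Differentiable ℝ f) (lam : ℝ)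
    (hroot : f lam = 0) (hlam : 4 < lam ^ 4)
    (F : (Fin 4 → ℝ) → (Fin 4 → ℝ))
    (hF : ∀ x, F x =
      ![x 0 * x 1 - (x 2) ^ 2,
        (x 0) ^ 2 + x 0 * x 1 - (x 1) ^ 2 - (x 2) ^ 2 - 1,
        x 3 / Real.sqrt 2 * ((x 0) ^ 2 + 2 * x 0 * x 1 - (x 2) ^ 2 - 1) - x 2 * (x 0 + x 1),
        -(Real.sqrt 2) * f (x 3) * x 2])
    (J : Matrix (Fin 4) (Fin 4) ℝ)
    (hJ : ∀ i j, J i j = fderiv ℝ (fun x => F x i)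
      ![lam ^ 2 / Real.sqrt (lam ^ 4 - 4), 2 / Real.sqrt (lam ^ 4 - 4),
        Real.sqrt 2 * lam / Real.sqrt (lam ^ 4 - 4), lam] (Pi.single j 1)) :
    J.charpoly =
      (X + C ((lam ^ 2 + 2) / Real.sqrt (lam ^ 4 - 4))) *
      (X + C (2 * lam * deriv f lam / Real.sqrt (lam ^ 4 - 4))) *
      (X ^ 2 + C ((lam ^ 2 + 2) / Real.sqrt (lam ^ 4 - 4)) * X + C 2) := by
  have hs : 0 < Real.sqrt (lam ^ 4 - 4) := Real.sqrt_pos.2 (by linarith)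
  have hs2 : Real.sqrt (lam ^ 4 - 4) ^ 2 = lam ^ 4 - 4 := Real.sq_sqrt (by linarith)
  have ht : 0 < Real.sqrt 2 := by positivity
  have ht2 : Real.sqrt 2 ^ 2 = 2 := Real.sq_sqrt (by norm_num)
  generalize Real.sqrt (lam ^ 4 - 4) = s at *
  generalize Real.sqrt 2 = t at *
  obtain ⟨p, hp⟩ : ∃ p : Fin 4 → ℝ, p = ![lam ^ 2 / s, 2 / s, t * lam / s, lam] := ⟨_, rfl⟩
  have hp0 : p 0 = lam ^ 2 / s := by simp [hp]
  have hp1 : p 1 = 2 / s := by simp [hp]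
  have hp2 : p 2 = t * lam / s := by simp [hp]
  have hp3 : p 3 = lam := by simp [hp]
  rw [← hp] at hJ
  have hx (i : Fin 4) : HasFDerivAt (fun x : Fin 4 → ℝ => x i)
      (ContinuousLinearMap.proj (R := ℝ) (φ := fun _ : Fin 4 => ℝ) i) p := hasFDerivAt_apply i p
  have hfx := (hf (p 3)).hasDerivAt.comp_hasFDerivAt p (hx 3)
  have h0 := ((hx 0).mul (hx 1)).sub ((hx 2).pow 2)
  have h1 := (((((hx 0).pow 2).add ((hx 0).mul (hx 1))).sub ((hx 1).pow 2)).sub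
    ((hx 2).pow 2)).sub_const 1
  have h2 := (((hx 3).mul_const t⁻¹).mul (((((hx 0).pow 2).add
    (((hx 0).const_mul 2).mul (hx 1))).sub ((hx 2).pow 2)).sub_const 1)).sub
    ((hx 2).mul ((hx 0).add (hx 1)))
  have h3 := (hfx.const_mul (-t)).mul (hx 2)
  have e0 (j) : J 0 j = _ := (hJ 0 j).trans
    (congrArg (· (Pi.single j 1)) (h0.congr_of_eventuallyEq (.of_forall fun x => by
      simp [hF])).fderiv)
  have e1 (j) : J 1 j = _ := (hJ 1 j).trans
    (congrArg (· (Pi.single j 1)) (h1.congr_of_eventuallyEq (.of_forall fun x => by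
      simp [hF])).fderiv)
  have e2 (j) : J 2 j = _ := (hJ 2 j).trans
    (congrArg (· (Pi.single j 1)) (h2.congr_of_eventuallyEq (.of_forall fun x => by
      simp [hF, div_eq_mul_inv])).fderiv)
  have e3 (j) : J 3 j = _ := (hJ 3 j).trans
    (congrArg (· (Pi.single j 1)) (h3.congr_of_eventuallyEq (.of_forall fun x => by
      simp [hF])).fderiv)
  have key := charpoly_of_jacobian_entries (lam ^ 2 / s) (2 / s) (t * lam / s) (lam / t)
    (J 2 3) (2 * lam * deriv f lam / s) (by field_simp)
    (by field_simp; linear_combination lam ^ 2 * ht2)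
    (by field_simp; linear_combination -hs2)
  rw [add_div, ← key]
  congr 1
  ext i j
  fin_cases i <;> fin_cases j <;>
    simp [e0, e1, e2, e3, hp0, hp1, hp2, hp3, hroot] <;>
    field_simp
  · ring
  · linear_combination lam * deriv f lam * ht2
end

section
/- Let f: ℝ → ℝ be differentiable. The point P_AdS = (1/√2, 1/√2, 0, 0) is a zero of the compactified four-dimensional vector field Ẋ₂ = −(λ/√2)X₂Y₁𝓘 + Y₁²(X₂(2X₂+X₃) − 1) − X₂X₃(X₂(3X₂+X₃) − 2), Ẋ₃ = −(λ/√2)X₃Y₁𝓘 − 3X₂²X₃² + 2X₂² − X₂X₃³ + X₃Y₁²(2X₂+X₃) + X₂X₃ + X₃² − 1, Ẏ₁ = (λ/√2)(1 − Y₁²)𝓘 − X₂Y₁(3X₂X₃ + X₃² + 1) + Y₁³(2X₂+X₃), λ̇ = −√2 Y₁ f(λ), where 𝓘 = 2X₂² + 2X₂X₃ + X₃² − 1, and the Jacobian matrix at P_AdS has characteristic polynomial (X + 3/√2)(X + √2)(X² + (3/√2)X + (3/2)f(0)). Consequently all complex eigenvalues of the Jacobian at P_AdS have negative real part if and only if f(0)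 > 0, so the anti-de Sitter point is a hyperbolic sink exactly when f(0) > 0. -/
open Polynomial

/-- A monic real quadratic `X² + bX + c` with `b > 0` has all its complex roots in the open left
half-plane if and only if `c > 0`. -/
lemma forall_quadratic_root_re_neg_iff {b c : ℝ} (hb : 0 < b) :
    (∀ z : ℂ, z ^ 2 + b * z + c = 0 → z.re < 0) ↔ 0 < c := by
  constructor
  · intro h
    by_contra! hc
    have hs : Real.sqrt (b ^ 2 - 4 * c) ^ 2 = b ^ 2 - 4 * c :=
      Real.sq_sqrt (by nlinarith [sq_nonneg b])
    have hle : b ≤ Real.sqrt (b ^ 2 - 4 * c) := Real.le_sqrt_of_sq_le (by linarith)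
    have hroot := h (((-b + Real.sqrt (b ^ 2 - 4 * c)) / 2 : ℝ) : ℂ) (by
      norm_cast
      linear_combination hs / 4)
    rw [Complex.ofReal_re] at hroot
    linarith
  · intro hc z hz
    have hre := congrArg Complex.re hz
    have him := congrArg Complex.im hz
    simp only [pow_two, Complex.add_re, Complex.mul_re, Complex.add_im, Complex.mul_im,
      Complex.ofReal_re, Complex.ofReal_im, Complex.zero_re, Complex.zero_im] at hre him
    by_contra! hz0
    have hy : z.im * (2 * z.re + b) = 0 := by linear_combination him
    rcases mul_eq_zero.1 hy with h | h
    · rw [h] at hre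
      nlinarith [mul_nonneg hb.le hz0, mul_nonneg hz0 hz0]
    · linarith

/-- For differentiable `f`, the point `P_AdS = (1/√2, 1/√2, 0, 0)` is a zero of
the compactified four-dimensional vector field, its Jacobian matrix has
characteristic polynomial `(X + 3/√2)(X + √2)(X² + (3/√2)X + (3/2)f(0))`, and all
complex eigenvalues of the Jacobian have negative real part if and only if
`f(0) > 0`: the anti-de Sitter point is a hyperbolic sink exactly when `f(0) > 0`. -/
theorem stmt18 (f : ℝ → ℝ) (hf : Differentiable ℝ f)
    (F : (Fin 4 → ℝ) → (Fin 4 → ℝ))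
    (hF : ∀ x, F x =
      ![-(x 3 / Real.sqrt 2) * x 0 * x 2 *
            (2 * (x 0) ^ 2 + 2 * x 0 * x 1 + (x 1) ^ 2 - 1)
          + (x 2) ^ 2 * (x 0 * (2 * x 0 + x 1) - 1)
          - x 0 * x 1 * (x 0 * (3 * x 0 + x 1) - 2),
        -(x 3 / Real.sqrt 2) * x 1 * x 2 *
            (2 * (x 0) ^ 2 + 2 * x 0 * x 1 + (x 1) ^ 2 - 1)
          - 3 * (x 0) ^ 2 * (x 1) ^ 2 + 2 * (x 0) ^ 2 - x 0 * (x 1) ^ 3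
          + x 1 * (x 2) ^ 2 * (2 * x 0 + x 1) + x 0 * x 1 + (x 1) ^ 2 - 1,
        (x 3 / Real.sqrt 2) * (1 - (x 2) ^ 2) *
            (2 * (x 0) ^ 2 + 2 * x 0 * x 1 + (x 1) ^ 2 - 1)
          - x 0 * x 2 * (3 * x 0 * x 1 + (x 1) ^ 2 + 1)
          + (x 2) ^ 3 * (2 * x 0 + x 1),
        -(Real.sqrt 2) * x 2 * f (x 3)])
    (J : Matrix (Fin 4) (Fin 4) ℝ)
    (hJ : ∀ i j, J i j = fderiv ℝ (fun x => F x i)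
      ![1 / Real.sqrt 2, 1 / Real.sqrt 2, 0, 0] (Pi.single j 1)) :
    F ![1 / Real.sqrt 2, 1 / Real.sqrt 2, 0, 0] = 0 ∧
    J.charpoly =
      (X + C (3 / Real.sqrt 2)) * (X + C (Real.sqrt 2)) *
        (X ^ 2 + C (3 / Real.sqrt 2) * X + C (3 / 2 * f 0)) ∧
    ((∀ z : ℂ, (J.charpoly.map (algebraMap ℝ ℂ)).IsRoot z → z.re < 0) ↔ 0 < f 0) := by
  obtain ⟨s, hs⟩ : ∃ s, s = Real.sqrt 2 := ⟨_, rfl⟩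
  have hs2 : s ^ 2 = 2 := by rw [hs]; exact Real.sq_sqrt (by norm_num)
  have hpos : 0 < s := by rw [hs]; positivity
  have hinv : 1 / s = s / 2 := by field_simp; linarith
  have hdiv : 3 / s = 3 * s / 2 := by field_simp; linarith
  have hinv' : s⁻¹ = s / 2 := by rw [← one_div, hinv]
  rw [← hs] at hF hJ ⊢
  rw [hinv] at hJ ⊢
  rw [hdiv]
  set a : Fin 4 → ℝ := ![s / 2, s / 2, 0, 0] with ha
  have h0 : HasFDerivAt (fun x : Fin 4 → ℝ => x 0) _ a := hasFDerivAt_apply (𝕜 := ℝ) 0 a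
  have h1 : HasFDerivAt (fun x : Fin 4 → ℝ => x 1) _ a := hasFDerivAt_apply (𝕜 := ℝ) 1 a
  have h2 : HasFDerivAt (fun x : Fin 4 → ℝ => x 2) _ a := hasFDerivAt_apply (𝕜 := ℝ) 2 a
  have h3 : HasFDerivAt (fun x : Fin 4 → ℝ => x 3) _ a := hasFDerivAt_apply (𝕜 := ℝ) 3 a
  have hI := ((((h0.pow 2).const_mul 2).add ((h0.const_mul 2).mul h1)).add
    (h1.pow 2)).sub_const 1
  have hF0 := (((((h3.mul_const s⁻¹).neg.mul h0).mul h2).mul hI).add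
    ((h2.pow 2).mul ((h0.mul ((h0.const_mul 2).add h1)).sub_const 1))).sub
    ((h0.mul h1).mul ((h0.mul ((h0.const_mul 3).add h1)).sub_const 2))
  have hF1 := (((((((((h3.mul_const s⁻¹).neg.mul h1).mul h2).mul hI).sub
    (((h0.pow 2).const_mul 3).mul (h1.pow 2))).add ((h0.pow 2).const_mul 2)).sub
    (h0.mul (h1.pow 3))).add ((h1.mul (h2.pow 2)).mul ((h0.const_mul 2).add h1))).add
    (h0.mul h1)).add (h1.pow 2) |>.sub_const 1
  have hF2 := ((((h3.mul_const s⁻¹).mul ((h2.pow 2).const_sub 1)).mul hI).sub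
    ((h0.mul h2).mul ((((h0.const_mul 3).mul h1).add (h1.pow 2)).add_const 1))).add
    ((h2.pow 3).mul ((h0.const_mul 2).add h1))
  have hF3 := (h2.const_mul (-s)).mul ((hf (a 3)).hasDerivAt.comp_hasFDerivAt a h3)
  have hJ0 : ∀ j, J 0 j = _ := fun j => (hJ 0 j).trans (congrArg (fun L => L (Pi.single j 1))
    (hF0.congr_of_eventuallyEq (.of_forall fun x => by simp [hF, div_eq_mul_inv])).fderiv)
  have hJ1 : ∀ j, J 1 j = _ := fun j => (hJ 1 j).trans (congrArg (fun L => L (Pi.single j 1))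
    (hF1.congr_of_eventuallyEq (.of_forall fun x => by simp [hF, div_eq_mul_inv])).fderiv)
  have hJ2 : ∀ j, J 2 j = _ := fun j => (hJ 2 j).trans (congrArg (fun L => L (Pi.single j 1))
    (hF2.congr_of_eventuallyEq (.of_forall fun x => by simp [hF, div_eq_mul_inv])).fderiv)
  have hJ3 : ∀ j, J 3 j = _ := fun j => (hJ 3 j).trans (congrArg (fun L => L (Pi.single j 1))
    (hF3.congr_of_eventuallyEq (.of_forall fun x => by simp [hF])).fderiv)
  have hs3 : s ^ 3 = 2 * s := by linear_combination s * hs2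
  have hs4 : s ^ 4 = 4 := by linear_combination (s ^ 2 + 2) * hs2
  have hJmat : J = !![-(7 / 4 * s), -(s / 4), 0, 0; 3 / 4 * s, -(3 / 4 * s), 0, 0;
      0, 0, -(3 / 2 * s), 3 / 4 * s; 0, 0, -(s * f 0), 0] := by
    ext i j
    fin_cases i <;> fin_cases j <;>
      simp [hJ0, hJ1, hJ2, hJ3, ha, hinv'] <;> ring_nf <;>
      (try simp only [hs3]) <;> ring
  have hchar : J.charpoly = (X + C (3 * s / 2)) * (X + C s) *
      (X ^ 2 + C (3 * s / 2) * X + C (3 / 2 * f 0)) := by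
    refine Polynomial.funext fun t => ?_
    rw [Matrix.eval_charpoly, hJmat]
    simp [Matrix.det_succ_row_zero, Fin.sum_univ_succ, Fin.succAbove]
    linear_combination f 0 * (15 / 8 * t * s + 3 / 4 * t ^ 2 + 9 / 8 * s ^ 2) * hs2
  refine ⟨?_, hchar, ?_⟩
  · rw [hF]
    ext i
    fin_cases i <;> simp [ha] <;> ring_nf <;> (try simp only [hs2, hs4]) <;> norm_num
  · have hb : 0 < 3 * s / 2 := by positivity
    have hc : 0 < f 0 ↔ 0 < 3 / 2 * f 0 := by constructor <;> intro h <;> linarith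
    rw [hc, ← forall_quadratic_root_re_neg_iff hb, hchar]
    have hlin : ∀ {r : ℝ} {z : ℂ}, 0 < r → z + r = 0 → z.re < 0 := fun {r z} hr hz => by
      rw [eq_neg_of_add_eq_zero_left hz]
      simpa using hr
    have hroot : ∀ z : ℂ, (((X + C (3 * s / 2)) * (X + C s) *
        (X ^ 2 + C (3 * s / 2) * X + C (3 / 2 * f 0))).map (algebraMap ℝ ℂ)).IsRoot z ↔
        (z + (3 * s / 2 : ℝ) = 0 ∨ z + s = 0) ∨
          z ^ 2 + (3 * s / 2 : ℝ) * z + (3 / 2 * f 0 : ℝ) = 0 := fun z => by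
      simp [IsRoot.def]
    simp only [hroot]
    exact ⟨fun h z hz => h z (.inr hz),
      fun h z hz => hz.elim (Or.elim · (hlin hb) (hlin hpos)) (h z)⟩
end
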